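/- In the system S□, an equation δ = δ' between D-terms is derivable if and only if the D-graphs ι(δ) and ι(δ') are the same. -/

import Mathlib

/-- A graph in the sense of the paper: a finite set of edges, a finite set of
vertices, and West/East end functions (values outside `A` are irrelevant junk,
canonically `0`). -/
structure DGr where
  A : Finset ℕ
  V : Finset ℕ
  W : ℕ → ℕ
  E : ℕ → ℕ

namespace DGr

/-- The `X`-end function of a graph: `true` stands for `W`, `false` for `E`. -/
def Xf (G : DGr) : Bool → ℕ → ℕ
  | true => G.W
  | false => G.E

/-- `vs`/`es` form a semiwalk: alternating vertices and edges, each edge joining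
its two neighbouring vertices in one of the two directions. -/
def IsSemiwalk (G : DGr) (vs es : List ℕ) : Prop :=
  vs.length = es.length + 1 ∧
  (∀ v ∈ vs, v ∈ G.V) ∧ (∀ a ∈ es, a ∈ G.A) ∧
  ∀ (i a u v : ℕ), es[i]? = some a → vs[i]? = some u → vs[i + 1]? = some v →
    (G.W a = u ∧ G.E a = v) ∨ (G.W a = v ∧ G.E a = u)

/-- A semipath is a semiwalk with no repeated vertex. -/
def IsSemipath (G : DGr) (vs es : List ℕ) : Prop :=
  G.IsSemiwalk vs es ∧ vs.Nodup

/-- A semipath from `u` to `v`. -/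
def SemipathFT (G : DGr) (u v : ℕ) (vs es : List ℕ) : Prop :=
  G.IsSemipath vs es ∧ vs.head? = some u ∧ vs.getLast? = some v

/-- A walk: all edges traversed from West to East. -/
def IsWalk (G : DGr) (vs es : List ℕ) : Prop :=
  vs.length = es.length + 1 ∧
  (∀ v ∈ vs, v ∈ G.V) ∧ (∀ a ∈ es, a ∈ G.A) ∧
  ∀ (i a u v : ℕ), es[i]? = some a → vs[i]? = some u → vs[i + 1]? = some v →
    G.W a = u ∧ G.E a = v

/-- A cycle: a non-trivial closed walk with no repeated vertex except endpoints. -/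
def IsCycle (G : DGr) (vs es : List ℕ) : Prop :=
  G.IsWalk vs es ∧ es ≠ [] ∧ vs.head? = vs.getLast? ∧ vs.dropLast.Nodup

def Acyclic (G : DGr) : Prop := ∀ vs es, ¬ G.IsCycle vs es

def WeaklyConnected (G : DGr) : Prop :=
  ∀ u ∈ G.V, ∀ v ∈ G.V, u ≠ v → ∃ vs es, G.SemipathFT u v vs es

/-- `v` is an `X`-vertex: no edge has its `X̄`-end at `v`. -/
def XVertex (G : DGr) (X : Bool) (v : ℕ) : Prop :=
  v ∈ G.V ∧ ∀ a ∈ G.A, G.Xf (!X) a ≠ v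

def InnerVertex (G : DGr) (v : ℕ) : Prop :=
  v ∈ G.V ∧ ¬ G.XVertex true v ∧ ¬ G.XVertex false v

/-- `a` is an `X`-edge: its `X`-end is an `X`-vertex. -/
def XEdge (G : DGr) (X : Bool) (a : ℕ) : Prop :=
  a ∈ G.A ∧ G.XVertex X (G.Xf X a)

def InnerEdge (G : DGr) (a : ℕ) : Prop :=
  a ∈ G.A ∧ ¬ G.XEdge true a ∧ ¬ G.XEdge false a

def WEFunctional (G : DGr) : Prop :=
  ∀ (X : Bool) (a : ℕ), G.XEdge X a → ∀ b ∈ G.A, b ≠ a → G.Xf X b ≠ G.Xf X a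

def WellFormed (G : DGr) : Prop := ∀ a ∈ G.A, G.W a ∈ G.V ∧ G.E a ∈ G.V

/-- A D-graph: finite (built in), acyclic, W-E-functional, weakly connected
graph with an inner vertex. -/
def IsDGraph (G : DGr) : Prop :=
  G.WellFormed ∧ G.Acyclic ∧ G.WEFunctional ∧ G.WeaklyConnected ∧ ∃ v, G.InnerVertex v

/-- A basic D-graph: a D-graph with a single inner vertex. -/
def IsBasicDGraph (G : DGr) : Prop :=
  G.IsDGraph ∧ ∃! v, G.InnerVertex v

/-- `ψ_X(v,u,w)`: every semipath in `[v,w]` and every semipath in `[u]_{X̄}`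
intersect. -/
def psi (G : DGr) (X : Bool) (v u w : ℕ) : Prop :=
  ∀ vs₁ es₁, G.SemipathFT v w vs₁ es₁ →
    ∀ t vs₂ es₂, G.XVertex (!X) t → G.SemipathFT u t vs₂ es₂ →
      ∃ z, z ∈ vs₁ ∧ z ∈ vs₂

/-- `y ▷ [x,z]`: `y` occurs in every semipath from `x` to `z`. -/
def inAll (G : DGr) (y x z : ℕ) : Prop :=
  ∀ vs es, G.SemipathFT x z vs es → y ∈ vs

/-- `y ≺ x`: `y` is a pivot of `x` (`y` occurs in every semipath in `[x]_W`). -/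
def Pivot (G : DGr) (y x : ℕ) : Prop :=
  y ≠ x ∧ ∀ t vs es, G.XVertex true t → G.SemipathFT x t vs es → y ∈ vs

/-- `y ≺_∃ x`: `y` occurs in some semipath in `[x]_W`. -/
def PivotE (G : DGr) (y x : ℕ) : Prop :=
  y ≠ x ∧ ∃ t vs es, G.XVertex true t ∧ G.SemipathFT x t vs es ∧ y ∈ vs

/-- `v CCP(x,y)`: `v` is the closest common pivot of `x` and `y`. -/
def CCP (G : DGr) (v x y : ℕ) : Prop :=
  G.Pivot v x ∧ G.Pivot v y ∧ ∀ w, G.Pivot w x → G.Pivot w y → (G.Pivot w v ∨ w = v)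

end DGr
/-- `x` precedes `y` in the list `L`. -/
def ltL (L : List ℕ) (x y : ℕ) : Prop :=
  ∃ i j : ℕ, i < j ∧ L[i]? = some x ∧ L[j]? = some y

/-- `L : x−y−z`: `x`, `y`, `z` occur in `L` in that order or in the reverse order. -/
def BtwL (L : List ℕ) (x y z : ℕ) : Prop :=
  (ltL L x y ∧ ltL L y z) ∨ (ltL L z y ∧ ltL L y x)

/-- `L : x−y−u−z`. -/
def Btw4L (L : List ℕ) (x y u z : ℕ) : Prop :=
  (ltL L x y ∧ ltL L y u ∧ ltL L u z) ∨ (ltL L z u ∧ ltL L u y ∧ ltL L y x)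

namespace DGr

/-- `L` is a list of all `X`-vertices of `G`. -/
def IsListOfX (G : DGr) (X : Bool) (L : List ℕ) : Prop :=
  L.Nodup ∧ ∀ v, v ∈ L ↔ G.XVertex X v

/-- `L` is grounded in `G` (w.r.t. the `X`-vertices): `L : v−u−w` implies `ψ_X(v,u,w)`. -/
def GroundedIn (G : DGr) (X : Bool) (L : List ℕ) : Prop :=
  ∀ v u w, BtwL L v u w → G.psi X v u w

end DGr

/-- Two non-empty lists are compatible: they are of the forms `ΦΞ` and `ΞΨ`, or
`ΦΞΨ` and `Ξ`, for mutually disjoint lists `Φ`, `Ξ`, `Ψ` with `Ξ` non-empty. -/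
def ListCompat (L₁ L₂ : List ℕ) : Prop :=
  ∃ Φ Ξ Ψ : List ℕ, Ξ ≠ [] ∧ Φ.Nodup ∧ Ξ.Nodup ∧ Ψ.Nodup ∧
    Φ.Disjoint Ξ ∧ Φ.Disjoint Ψ ∧ Ξ.Disjoint Ψ ∧
    ((L₁ = Φ ++ Ξ ∧ L₂ = Ξ ++ Ψ) ∨ (L₂ = Φ ++ Ξ ∧ L₁ = Ξ ++ Ψ) ∨
     (L₁ = Φ ++ Ξ ++ Ψ ∧ L₂ = Ξ) ∨ (L₂ = Φ ++ Ξ ++ Ψ ∧ L₁ = Ξ))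

namespace DGr

/-- The conditions under which the juncture `G₁ □ G₂` is defined. -/
def JuncDefined (G₁ G₂ : DGr) : Prop :=
  G₁.IsDGraph ∧ G₂.IsDGraph ∧
  (G₁.A ∩ G₂.A).Nonempty ∧
  (∀ a ∈ G₁.A ∩ G₂.A, G₁.E a = G₂.W a ∧ G₁.XEdge false a ∧ G₂.XEdge true a) ∧
  G₁.V ∩ G₂.V = (G₁.A ∩ G₂.A).image G₁.E

/-- The juncture `G₁ □ G₂` of two graphs. -/
def junc (G₁ G₂ : DGr) : DGr where
  A := G₁.A ∪ G₂.A
  V := (G₁.V ∪ G₂.V) \ (G₁.A ∩ G₂.A).image G₁.E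
  W := fun a => if a ∈ G₁.A then G₁.W a else if a ∈ G₂.A then G₂.W a else 0
  E := fun a => if a ∈ G₂.A then G₂.E a else if a ∈ G₁.A then G₁.E a else 0

/-- `G₁` and `G₂` are P-compatible: the juncture is defined, and some list of all
E-vertices of `G₁` grounded in `G₁` and some list of all W-vertices of `G₂`
grounded in `G₂` are compatible. -/
def PCompat (G₁ G₂ : DGr) : Prop :=
  G₁.JuncDefined G₂ ∧
  ∃ Λ₁ Λ₂ : List ℕ,
    G₁.IsListOfX false Λ₁ ∧ G₁.GroundedIn false Λ₁ ∧
    G₂.IsListOfX true Λ₂ ∧ G₂.GroundedIn true Λ₂ ∧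
    ListCompat Λ₁ Λ₂

end DGr

/-- Constructions of P′-graphs: `Construction D L_W L_E` says that there is a
construction whose root carries the triple `(D, L_W, L_E)`. -/
inductive Construction : DGr → List ℕ → List ℕ → Prop
  | basic (G : DGr) (LW LE : List ℕ) :
      G.IsBasicDGraph → G.IsListOfX true LW → G.IsListOfX false LE →
      Construction G LW LE
  | box (GW GE : DGr) (LWW LEE Φe Ξ Ψe Φw Ψw : List ℕ) :
      Construction GW LWW (Φe ++ Ξ ++ Ψe) →
      Construction GE (Φw ++ Ξ ++ Ψw) LEE →
      GW.JuncDefined GE →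
      Ξ ≠ [] →
      (Φe = [] ∨ Φw = []) → (Ψe = [] ∨ Ψw = []) →
      Φe.Disjoint Ξ → Φe.Disjoint Ψe → Ξ.Disjoint Ψe →
      Φw.Disjoint Ξ → Φw.Disjoint Ψw → Ξ.Disjoint Ψw →
      Φe.Disjoint Φw → Φe.Disjoint Ψw → Ψe.Disjoint Φw → Ψe.Disjoint Ψw →
      Construction (GW.junc GE) (Φw ++ LWW ++ Ψw) (Φe ++ LEE ++ Ψe)

/-- A P′-graph is the root graph of a construction. -/
def IsP1Graph (G : DGr) : Prop := ∃ LW LE, Construction G LW LE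

/-- P″-graphs: basic D-graphs, closed under juncture of P-compatible pairs. -/
inductive IsP2Graph : DGr → Prop
  | basic (G : DGr) : G.IsBasicDGraph → IsP2Graph G
  | box (GW GE : DGr) : IsP2Graph GW → IsP2Graph GE → GW.PCompat GE →
      IsP2Graph (GW.junc GE)

namespace DGr

/-- `H` is a subgraph of `G`. -/
def IsSubgraph (H G : DGr) : Prop :=
  H.A ⊆ G.A ∧ H.V ⊆ G.V ∧ ∀ a ∈ H.A, H.W a = G.W a ∧ H.E a = G.E a

/-- `H` is a component of `G`: a maximal weakly connected non-empty subgraph. -/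
def IsComponent (H G : DGr) : Prop :=
  H.IsSubgraph G ∧ H.V.Nonempty ∧ H.WeaklyConnected ∧
  ∀ H' : DGr, H'.IsSubgraph G → H'.WeaklyConnected → H.IsSubgraph H' → H'.IsSubgraph H

/-- Canonical graphs: the end functions are `0` outside the edge set.  Each
component of a graph has exactly one canonical representative. -/
def Canonical (H : DGr) : Prop := ∀ a, a ∉ H.A → H.W a = 0 ∧ H.E a = 0

def IsComponentC (H G : DGr) : Prop := H.IsComponent G ∧ H.Canonical

/-- The graph left after removing the set `S` of edges from `G`. -/
def removeEdges (G : DGr) (S : Finset ℕ) : DGr := ⟨G.A \ S, G.V, G.W, G.E⟩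

end DGr

/-- The edge relation of the componential graph `C_S(D)`, on (canonical)
components of the graph obtained by removing `S` from `D`. -/
def compEdge (D : DGr) (S : Finset ℕ) (H₁ H₂ : DGr) : Prop :=
  H₁.IsComponentC (D.removeEdges S) ∧ H₂.IsComponentC (D.removeEdges S) ∧ H₁ ≠ H₂ ∧
  ∃ a ∈ S, D.W a ∈ H₁.V ∧ D.E a ∈ H₂.V

/-- `S` is a strict cutset of `D`. -/
def IsStrictCutset (D : DGr) (S : Finset ℕ) : Prop :=
  (∀ a ∈ S, D.InnerEdge a) ∧
  2 ≤ {H : DGr | H.IsComponentC (D.removeEdges S)}.ncard ∧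
  (∀ a ∈ S, ∃ H₁ H₂ : DGr, H₁.IsComponentC (D.removeEdges S) ∧
     H₂.IsComponentC (D.removeEdges S) ∧ H₁ ≠ H₂ ∧ D.W a ∈ H₁.V ∧ D.E a ∈ H₂.V) ∧
  ∀ H : DGr, ¬ Relation.TransGen (compEdge D S) H H

/-- A cocycle is a strict cutset whose removal leaves exactly two components. -/
def IsCocycle (D : DGr) (C : Finset ℕ) : Prop :=
  IsStrictCutset D C ∧ {H : DGr | H.IsComponentC (D.removeEdges C)}.ncard = 2

/-- `(DW, DE)` are (up to the choice of fresh vertices) the two D-graphs obtained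
by cutting `D` through the cocycle `C`. -/
def IsCutting (D : DGr) (C : Finset ℕ) (DW DE : DGr) : Prop :=
  ∃ (H₁ H₂ : DGr) (f : ℕ → ℕ),
    H₁.IsComponentC (D.removeEdges C) ∧ H₂.IsComponentC (D.removeEdges C) ∧ H₁ ≠ H₂ ∧
    (∀ a ∈ C, D.W a ∈ H₁.V ∧ D.E a ∈ H₂.V) ∧
    Set.InjOn f ↑C ∧ (∀ a ∈ C, f a ∉ D.V) ∧
    DW = ⟨H₁.A ∪ C, H₁.V ∪ C.image f,
          fun a => if a ∈ C then D.W a else H₁.W a,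
          fun a => if a ∈ C then f a else H₁.E a⟩ ∧
    DE = ⟨H₂.A ∪ C, H₂.V ∪ C.image f,
          fun a => if a ∈ C then f a else H₂.W a,
          fun a => if a ∈ C then D.E a else H₂.E a⟩

/-- A P‴-graph: a D-graph such that for every cocycle `C`, the two D-graphs
obtained by cutting through `C` are P-compatible. -/
def IsP3Graph (D : DGr) : Prop :=
  D.IsDGraph ∧ ∀ C DW DE, IsCocycle D C → IsCutting D C DW DE → DW.PCompat DE
/-! ### D-terms and the system S□ -/

/-- Syntax of D-terms over basic D-terms indexed by natural numbers. -/
inductive DTerm where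
  | basic : ℕ → DTerm
  | box : DTerm → DTerm → DTerm

namespace DTerm

/-- The set `A(δ)` of edges of a D-term, given the assignments `Wb`, `Eb` of
West- and East-edge sets to basic D-terms. -/
def Aset (Wb Eb : ℕ → Finset ℕ) : DTerm → Finset ℕ
  | basic n => Wb n ∪ Eb n
  | box l r => Aset Wb Eb l ∪ Aset Wb Eb r

/-- The set `W(δ)` of West edges of a D-term. -/
def Wset (Wb Eb : ℕ → Finset ℕ) : DTerm → Finset ℕ
  | basic n => Wb n
  | box l r => Wset Wb Eb l ∪ (Wset Wb Eb r \ (Aset Wb Eb l ∩ Aset Wb Eb r))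

/-- The set `E(δ)` of East edges of a D-term. -/
def Eset (Wb Eb : ℕ → Finset ℕ) : DTerm → Finset ℕ
  | basic n => Eb n
  | box l r => Eset Wb Eb r ∪ (Eset Wb Eb l \ (Aset Wb Eb l ∩ Aset Wb Eb r))

/-- Well-formedness: the expression is a genuine D-term. -/
def Good (Wb Eb : ℕ → Finset ℕ) : DTerm → Prop
  | basic _ => True
  | box l r => Good Wb Eb l ∧ Good Wb Eb r ∧
      (Aset Wb Eb l ∩ Aset Wb Eb r).Nonempty ∧
      Aset Wb Eb l ∩ Aset Wb Eb r = Eset Wb Eb l ∩ Wset Wb Eb r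

/-- The interpretation `ι` of D-terms in D-graphs, given the assignments of
edge sets to basic D-terms and the injections `ve` (edges to outer vertices)
and `vb` (basic D-terms to inner vertices). -/
def iota (Wb Eb : ℕ → Finset ℕ) (ve vb : ℕ → ℕ) : DTerm → DGr
  | basic n =>
      ⟨Wb n ∪ Eb n, (Wb n ∪ Eb n).image ve ∪ {vb n},
       fun a => if a ∈ Wb n then ve a else if a ∈ Eb n then vb n else 0,
       fun a => if a ∈ Eb n then ve a else if a ∈ Wb n then vb n else 0⟩
  | box l r => (iota Wb Eb ve vb l).junc (iota Wb Eb ve vb r)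

end DTerm

/-- Derivability of equations between D-terms in the system S□. -/
inductive Deriv (Wb Eb : ℕ → Finset ℕ) : DTerm → DTerm → Prop
  | refl (δ : DTerm) : δ.Good Wb Eb → Deriv Wb Eb δ δ
  | ass1 (δ₁ δ₂ δ₃ : DTerm) :
      (DTerm.box (DTerm.box δ₁ δ₂) δ₃).Good Wb Eb →
      (DTerm.box δ₁ (DTerm.box δ₂ δ₃)).Good Wb Eb →
      Deriv Wb Eb (DTerm.box (DTerm.box δ₁ δ₂) δ₃) (DTerm.box δ₁ (DTerm.box δ₂ δ₃))
  | ass21 (δ₁ δ₂ δ₃ : DTerm) :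
      (DTerm.box (DTerm.box δ₁ δ₂) δ₃).Good Wb Eb →
      (DTerm.box (DTerm.box δ₁ δ₃) δ₂).Good Wb Eb →
      Deriv Wb Eb (DTerm.box (DTerm.box δ₁ δ₂) δ₃) (DTerm.box (DTerm.box δ₁ δ₃) δ₂)
  | ass22 (δ₁ δ₂ δ₃ : DTerm) :
      (DTerm.box δ₁ (DTerm.box δ₂ δ₃)).Good Wb Eb →
      (DTerm.box δ₂ (DTerm.box δ₁ δ₃)).Good Wb Eb →
      Deriv Wb Eb (DTerm.box δ₁ (DTerm.box δ₂ δ₃)) (DTerm.box δ₂ (DTerm.box δ₁ δ₃))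
  | symm {δ δ' : DTerm} : Deriv Wb Eb δ δ' → Deriv Wb Eb δ' δ
  | trans {δ₁ δ₂ δ₃ : DTerm} : Deriv Wb Eb δ₁ δ₂ → Deriv Wb Eb δ₂ δ₃ → Deriv Wb Eb δ₁ δ₃
  | congr {δ₁ δ₂ δ₃ δ₄ : DTerm} : Deriv Wb Eb δ₁ δ₂ → Deriv Wb Eb δ₃ δ₄ →
      (DTerm.box δ₁ δ₃).Good Wb Eb → (DTerm.box δ₂ δ₄).Good Wb Eb →
      Deriv Wb Eb (DTerm.box δ₁ δ₃) (DTerm.box δ₂ δ₄)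

namespace SBox

/-- Basic terms occurring in a term. -/
def N : DTerm → Finset ℕ
  | DTerm.basic n => {n}
  | DTerm.box l r => N l ∪ N r

section conn
variable (D : ℕ → ℕ → Prop)

def adj (x y : ℕ) : Prop := D x y ∨ D y x

theorem adj_symm {D : ℕ → ℕ → Prop} {x y : ℕ} (h : adj D x y) : adj D y x := Or.symm h

def Conn (S : Finset ℕ) : Prop :=
  S.Nonempty ∧ ∀ P : ℕ → Prop, (∃ x ∈ S, P x) →
    (∀ x ∈ S, ∀ y ∈ S, P x → adj D x y → P y) → ∀ y ∈ S, P y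

theorem conn_singleton (n : ℕ) : Conn D {n} := by
  refine ⟨⟨n, by simp⟩, ?_⟩
  rintro P ⟨x, hx, hP⟩ _ y hy
  simp at hx hy
  subst hx; subst hy; exact hP

theorem conn_union {A B : Finset ℕ} (hA : Conn D A) (hB : Conn D B)
    {a b : ℕ} (ha : a ∈ A) (hb : b ∈ B) (h : a = b ∨ adj D a b) : Conn D (A ∪ B) := by
  refine ⟨⟨a, by simp [ha]⟩, ?_⟩
  rintro P ⟨x, hx, hP⟩ hcl
  have clA : ∀ x ∈ A, ∀ y ∈ A, P x → adj D x y → P y := fun x hx y hy =>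
    hcl x (Finset.mem_union_left _ hx) y (Finset.mem_union_left _ hy)
  have clB : ∀ x ∈ B, ∀ y ∈ B, P x → adj D x y → P y := fun x hx y hy =>
    hcl x (Finset.mem_union_right _ hx) y (Finset.mem_union_right _ hy)
  have hab : P a → P b := by
    intro h1
    rcases h with h | h
    · exact h ▸ h1
    · exact hcl a (Finset.mem_union_left _ ha) b (Finset.mem_union_right _ hb) h1 h
  have hba : P b → P a := by
    intro h1
    rcases h with h | h
    · exact h ▸ h1
    · exact hcl b (Finset.mem_union_right _ hb) a (Finset.mem_union_left _ ha) h1 (adj_symm h)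
  have hPa : P a := by
    rcases Finset.mem_union.1 hx with hx | hx
    · exact hA.2 P ⟨x, hx, hP⟩ clA a ha
    · exact hba (hB.2 P ⟨x, hx, hP⟩ clB b hb)
  intro y hy
  rcases Finset.mem_union.1 hy with hy | hy
  · exact hA.2 P ⟨a, ha, hPa⟩ clA y hy
  · exact hB.2 P ⟨b, hb, hab hPa⟩ clB y hy

theorem conn_edge {A B : Finset ℕ} (h : Conn D (A ∪ B)) (hA : A.Nonempty) (hB : B.Nonempty)
    (hd : Disjoint A B) : ∃ a ∈ A, ∃ b ∈ B, adj D a b := by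
  by_contra hc
  push Not at hc
  obtain ⟨a, ha⟩ := hA
  obtain ⟨b, hb⟩ := hB
  have := h.2 (fun x => x ∈ A) ⟨a, by simp [ha], ha⟩ (by
    intro x _ y hy hxA hxy
    rcases Finset.mem_union.1 hy with hy | hy
    · exact hy
    · exact absurd hxy (hc x hxA y hy)) b (by simp [hb])
  exact Finset.disjoint_left.1 hd this hb

/-- removing a union of components of `S \ K` from connected `S`, `K` connected. -/
theorem conn_sdiff {S K C : Finset ℕ} (hS : Conn D S) (hK : Conn D K) (hKS : K ⊆ S)
    (hCK : ∀ x ∈ C, x ∈ S ∧ x ∉ K)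
    (hC : ∀ x ∈ C, ∀ y ∈ S, y ∉ K → adj D x y → y ∈ C) : Conn D (S \ C) := by
  have key : ∀ P : ℕ → Prop, (∃ x ∈ S \ C, P x) →
      (∀ x ∈ S \ C, ∀ y ∈ S \ C, P x → adj D x y → P y) → ∃ k ∈ K, P k := by
    rintro P ⟨x, hx, hP⟩ hcl
    by_contra hno
    push Not at hno
    obtain ⟨k, hk⟩ := hK.1
    have := hS.2 (fun y => y ∈ S \ C ∧ P y) ⟨x, (Finset.mem_sdiff.1 hx).1, hx, hP⟩ (by
      rintro y hy z hz ⟨hyC, hPy⟩ hyz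
      have hzC : z ∉ C := by
        intro hzC
        have hyK : y ∉ K := fun h => hno y h hPy
        exact (Finset.mem_sdiff.1 hyC).2 (hC z hzC y hy hyK (adj_symm hyz))
      have hz' : z ∈ S \ C := Finset.mem_sdiff.2 ⟨hz, hzC⟩
      exact ⟨hz', hcl y hyC z hz' hPy hyz⟩) k (hKS hk)
    exact hno k hk this.2
  have hKC : ∀ k ∈ K, k ∈ S \ C := fun k hk =>
    Finset.mem_sdiff.2 ⟨hKS hk, fun h => (hCK k h).2 hk⟩
  obtain ⟨k0, hk0⟩ := hK.1
  refine ⟨⟨k0, hKC k0 hk0⟩, ?_⟩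
  intro P hex hcl
  have hall : ∀ k ∈ K, P k := hK.2 P (key P hex hcl)
    (fun x hx y hy => hcl x (hKC x hx) y (hKC y hy))
  by_contra hne
  push Not at hne
  obtain ⟨y, hy, hPy⟩ := hne
  obtain ⟨k, hk, hPk⟩ := key (fun x => ¬ P x) ⟨y, hy, hPy⟩
    (fun x hx z hz hPx hxz hPz => hPx (hcl z hz x hx hPz (adj_symm hxz)))
  exact hPk (hall k hk)

theorem exists_comp (X : Finset ℕ) (hX : X.Nonempty) :
    ∃ C ⊆ X, Conn D C ∧ ∀ x ∈ C, ∀ y ∈ X, adj D x y → y ∈ C := by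
  classical
  have : ∀ k, ∀ C ⊆ X, C.card ≤ k → C.Nonempty → (∀ x ∈ C, ∀ y ∈ X, adj D x y → y ∈ C) →
      ∃ C ⊆ X, Conn D C ∧ ∀ x ∈ C, ∀ y ∈ X, adj D x y → y ∈ C := by
    intro k
    induction k with
    | zero =>
      intro C _ hc hne
      simp at hc
      simp [hc] at hne
    | succ k ih =>
      intro C hCX hc hne hcl
      by_cases hcon : Conn D C
      · exact ⟨C, hCX, hcon, hcl⟩
      · have : ∃ P : ℕ → Prop, (∃ x ∈ C, P x) ∧
            (∀ x ∈ C, ∀ y ∈ C, P x → adj D x y → P y) ∧ ∃ y ∈ C, ¬ P y := by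
          by_contra hno
          apply hcon
          refine ⟨hne, fun P h1 h2 => ?_⟩
          by_contra h3
          push Not at h3
          exact hno ⟨P, h1, h2, h3⟩
        obtain ⟨P, ⟨x, hx, hPx⟩, h2, y, hy, hPy⟩ := this
        have hlt : (C.filter P).card < C.card := by
          apply Finset.card_lt_card
          refine ⟨Finset.filter_subset _ _, fun h => ?_⟩
          exact hPy (Finset.mem_filter.1 (h hy)).2
        refine ih (C.filter P) ((Finset.filter_subset _ _).trans hCX) (by omega)
          ⟨x, by simp [hx, hPx]⟩ ?_
        intro u hu v hv huv
        rw [Finset.mem_filter] at hu ⊢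
        have hvC := hcl u hu.1 v hv huv
        exact ⟨hvC, h2 u hu.1 v hvC hu.2 huv⟩
  exact this X.card X subset_rfl le_rfl hX (fun _ _ y hy _ => hy)

def Src (S : Finset ℕ) : Prop :=
  ∀ T ⊆ S, T.Nonempty → ∃ x ∈ T, ∀ y ∈ T, ¬ D y x

structure Spl (S L R : Finset ℕ) : Prop where
  un : L ∪ R = S
  disj : Disjoint L R
  cl : Conn D L
  cr : Conn D R
  no : ∀ x ∈ R, ∀ y ∈ L, ¬ D x y

end conn

section terms
variable (Wb Eb : ℕ → Finset ℕ)

def De (n m : ℕ) : Prop := ∃ e, e ∈ Eb n ∧ e ∈ Wb m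

def Cons (S : Finset ℕ) : Prop :=
  ∀ n ∈ S, ∀ m ∈ S, ∀ e, (e ∈ Eb n → e ∈ Eb m → n = m) ∧ (e ∈ Wb n → e ∈ Wb m → n = m)

theorem mem_Aset (δ : DTerm) (e : ℕ) :
    e ∈ δ.Aset Wb Eb ↔ ∃ n ∈ N δ, e ∈ Wb n ∨ e ∈ Eb n := by
  induction δ with
  | basic n => simp [DTerm.Aset, N]
  | box l r hl hr =>
    simp only [DTerm.Aset, N, Finset.mem_union, hl, hr]
    grind

structure Facts (δ : DTerm) : Prop where
  cons : Cons Wb Eb (N δ)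
  conn : Conn (De Wb Eb) (N δ)
  src : Src (De Wb Eb) (N δ)
  w : ∀ e, e ∈ δ.Wset Wb Eb ↔ (∃ n ∈ N δ, e ∈ Wb n) ∧ ∀ n ∈ N δ, e ∉ Eb n
  e : ∀ e, e ∈ δ.Eset Wb Eb ↔ (∃ n ∈ N δ, e ∈ Eb n) ∧ ∀ n ∈ N δ, e ∉ Wb n

variable (hWne : ∀ n, (Wb n).Nonempty)
    (hdisj : ∀ n, Disjoint (Wb n) (Eb n))

theorem cross {l r : DTerm} (hl : Facts Wb Eb l) (hr : Facts Wb Eb r)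
    (hg : l.Aset Wb Eb ∩ r.Aset Wb Eb = l.Eset Wb Eb ∩ r.Wset Wb Eb)
    {n m e : ℕ} (hn : n ∈ N l) (hm : m ∈ N r) (h1 : e ∈ Wb n ∨ e ∈ Eb n)
    (h2 : e ∈ Wb m ∨ e ∈ Eb m) : e ∈ Eb n ∧ e ∉ Wb n ∧ e ∈ Wb m ∧ e ∉ Eb m := by
  have h : e ∈ l.Aset Wb Eb ∩ r.Aset Wb Eb :=
    Finset.mem_inter.2 ⟨(mem_Aset Wb Eb l e).2 ⟨n, hn, h1⟩, (mem_Aset Wb Eb r e).2 ⟨m, hm, h2⟩⟩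
  rw [hg, Finset.mem_inter, hl.e, hr.w] at h
  have := h.1.2 n hn
  have := h.2.2 m hm
  tauto

include hWne hdisj

theorem facts (δ : DTerm) (hδ : δ.Good Wb Eb) : Facts Wb Eb δ ∧
    (∀ l r, δ = DTerm.box l r → Spl (De Wb Eb) (N δ) (N l) (N r)) := by
  induction δ with
  | basic n =>
    have hd : ∀ e, e ∈ Wb n → e ∉ Eb n := fun e he => Finset.disjoint_left.1 (hdisj n) he
    refine ⟨⟨?_, conn_singleton _ n, ?_, ?_, ?_⟩, by simp⟩
    · intro a ha b hb
      simp [N] at ha hb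
      simp [ha, hb]
    · intro T hT hne
      obtain ⟨x, hx⟩ := hne
      refine ⟨x, hx, ?_⟩
      intro y hy ⟨e, h1, h2⟩
      have := hT hx
      have := hT hy
      simp [N] at *
      grind
    · intro e; simp [DTerm.Wset, N]; exact hd e
    · intro e; simp [DTerm.Eset, N]; exact fun h h' => hd e h' h
  | box l r ihl ihr =>
    obtain ⟨gl, gr, hne, hg⟩ := hδ
    have hl := (ihl gl).1
    have hr := (ihr gr).1
    have cr := fun {n m e : ℕ} => @cross Wb Eb l r hl hr hg n m e
    have hdis : Disjoint (N l) (N r) := by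
      rw [Finset.disjoint_left]
      intro n h1 h2
      obtain ⟨e, he⟩ := hWne n
      exact (cr h1 h2 (Or.inl he) (Or.inl he)).2.1 he
    have hno : ∀ x ∈ N r, ∀ y ∈ N l, ¬ De Wb Eb x y := by
      rintro x hx y hy ⟨e, h1, h2⟩
      exact (cr hy hx (Or.inl h2) (Or.inr h1)).2.1 h2
    refine ⟨⟨?_, ?_, ?_, ?_, ?_⟩, ?_⟩
    · intro n hn m hm e
      simp only [N, Finset.mem_union] at hn hm
      have c1 := hl.cons
      have c2 := hr.cons
      rcases hn with hn | hn <;> rcases hm with hm | hm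
      · exact c1 n hn m hm e
      · exact ⟨fun a b => absurd b (cr hn hm (Or.inr a) (Or.inr b)).2.2.2,
          fun a b => absurd a (cr hn hm (Or.inl a) (Or.inl b)).2.1⟩
      · exact ⟨fun a b => absurd a (cr hm hn (Or.inr b) (Or.inr a)).2.2.2,
          fun a b => absurd b (cr hm hn (Or.inl b) (Or.inl a)).2.1⟩
      · exact c2 n hn m hm e
    · obtain ⟨e, he⟩ := hne
      rw [Finset.mem_inter, mem_Aset, mem_Aset] at he
      obtain ⟨⟨n, hn, h1⟩, m, hm, h2⟩ := he
      have := cr hn hm h1 h2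
      exact conn_union _ hl.conn hr.conn hn hm (Or.inr (Or.inl ⟨e, this.1, this.2.2.1⟩))
    · intro T hT hTn
      by_cases h : (T ∩ N l).Nonempty
      · obtain ⟨x, hx, hx'⟩ := hl.src (T ∩ N l) Finset.inter_subset_right h
        rw [Finset.mem_inter] at hx
        refine ⟨x, hx.1, fun y hy => ?_⟩
        rcases Finset.mem_union.1 (hT hy) with h1 | h1
        · exact hx' y (Finset.mem_inter.2 ⟨hy, h1⟩)
        · exact hno y h1 x hx.2
      · refine hr.src T (fun y hy => ?_) hTn
        rcases Finset.mem_union.1 (hT hy) with h1 | h1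
        · exact absurd ⟨y, Finset.mem_inter.2 ⟨hy, h1⟩⟩ h
        · exact h1
    · intro e
      simp only [DTerm.Wset, N, Finset.mem_union, Finset.mem_sdiff, hl.w, hr.w, Finset.mem_inter,
        mem_Aset]
      constructor
      · rintro (⟨⟨n, hn, h1⟩, h2⟩ | ⟨⟨⟨n, hn, h1⟩, h2⟩, h3⟩)
        · refine ⟨⟨n, Or.inl hn, h1⟩, ?_⟩
          rintro m (hm | hm) h4
          · exact h2 m hm h4
          · exact (cr hn hm (Or.inl h1) (Or.inr h4)).2.1 h1
        · refine ⟨⟨n, Or.inr hn, h1⟩, ?_⟩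
          rintro m (hm | hm) h4
          · exact h3 ⟨⟨m, hm, Or.inr h4⟩, n, hn, Or.inl h1⟩
          · exact h2 m hm h4
      · rintro ⟨⟨n, hn | hn, h1⟩, h2⟩
        · exact Or.inl ⟨⟨n, hn, h1⟩, fun m hm => h2 m (Or.inl hm)⟩
        · refine Or.inr ⟨⟨⟨n, hn, h1⟩, fun m hm => h2 m (Or.inr hm)⟩, ?_⟩
          rintro ⟨⟨m, hm, h3⟩, -⟩
          exact h2 m (Or.inl hm) (cr hm hn h3 (Or.inl h1)).1
    · intro e
      simp only [DTerm.Eset, N, Finset.mem_union, Finset.mem_sdiff, hl.e, hr.e, Finset.mem_inter,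
        mem_Aset]
      constructor
      · rintro (⟨⟨n, hn, h1⟩, h2⟩ | ⟨⟨⟨n, hn, h1⟩, h2⟩, h3⟩)
        · refine ⟨⟨n, Or.inr hn, h1⟩, ?_⟩
          rintro m (hm | hm) h4
          · exact (cr hm hn (Or.inl h4) (Or.inr h1)).2.1 h4
          · exact h2 m hm h4
        · refine ⟨⟨n, Or.inl hn, h1⟩, ?_⟩
          rintro m (hm | hm) h4
          · exact h2 m hm h4
          · exact h3 ⟨⟨n, hn, Or.inr h1⟩, m, hm, Or.inl h4⟩
      · rintro ⟨⟨n, hn | hn, h1⟩, h2⟩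
        · refine Or.inr ⟨⟨⟨n, hn, h1⟩, fun m hm => h2 m (Or.inl hm)⟩, ?_⟩
          rintro ⟨-, ⟨m, hm, h3⟩⟩
          exact h2 m (Or.inr hm) (cr hn hm (Or.inr h1) h3).2.2.1
        · exact Or.inl ⟨⟨n, hn, h1⟩, fun m hm => h2 m (Or.inr hm)⟩
    · intro l' r' h
      cases h
      exact ⟨rfl, hdis, hl.conn, hr.conn, hno⟩

theorem good_box {S : Finset ℕ} (hS : Conn (De Wb Eb) S) (hC : Cons Wb Eb S) {l r : DTerm}
    (gl : l.Good Wb Eb) (gr : r.Good Wb Eb) (h : Spl (De Wb Eb) S (N l) (N r)) :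
    (DTerm.box l r).Good Wb Eb := by
  have hl := (facts Wb Eb hWne hdisj l gl).1
  have hr := (facts Wb Eb hWne hdisj r gr).1
  have inl : ∀ x ∈ N l, x ∈ S := fun x hx => h.un ▸ Finset.mem_union_left _ hx
  have inr : ∀ x ∈ N r, x ∈ S := fun x hx => h.un ▸ Finset.mem_union_right _ hx
  have hd : ∀ {x}, x ∈ N l → x ∉ N r := fun {x} hx => Finset.disjoint_left.1 h.disj hx
  refine ⟨gl, gr, ?_, ?_⟩
  · obtain ⟨a, ha, b, hb, hab⟩ := conn_edge _ (h.un ▸ hS) h.cl.1 h.cr.1 h.disj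
    rcases hab with ⟨e, h1, h2⟩ | h3
    · exact ⟨e, Finset.mem_inter.2 ⟨(mem_Aset Wb Eb l e).2 ⟨a, ha, Or.inr h1⟩,
        (mem_Aset Wb Eb r e).2 ⟨b, hb, Or.inl h2⟩⟩⟩
    · exact absurd h3 (h.no b hb a ha)
  · ext e
    rw [Finset.mem_inter, Finset.mem_inter, mem_Aset, mem_Aset, hl.e, hr.w]
    constructor
    · rintro ⟨⟨n, hn, h1⟩, m, hm, h2⟩
      have hnm : n ≠ m := by rintro rfl; exact hd hn hm
      have c := hC n (inl n hn) m (inr m hm) e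
      have hno : ¬ (e ∈ Eb m ∧ e ∈ Wb n) := fun h' => h.no m hm n hn ⟨e, h'⟩
      have h3 : e ∈ Eb n ∧ e ∈ Wb m := by tauto
      refine ⟨⟨⟨n, hn, h3.1⟩, fun k hk hk' => ?_⟩, ⟨m, hm, h3.2⟩, fun k hk hk' => ?_⟩
      · have := (hC k (inl k hk) m (inr m hm) e).2 hk' h3.2
        exact hd hk (this ▸ hm)
      · have := (hC n (inl n hn) k (inr k hk) e).1 h3.1 hk'
        exact hd hn (this ▸ hk)
    · rintro ⟨⟨⟨n, hn, h1⟩, -⟩, ⟨m, hm, h2⟩, -⟩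
      exact ⟨⟨n, hn, Or.inr h1⟩, m, hm, Or.inl h2⟩

omit hWne hdisj in
theorem Cons.mono {S T : Finset ℕ} (h : Cons Wb Eb S) (hT : T ⊆ S) : Cons Wb Eb T :=
  fun n hn m hm => h n (hT hn) m (hT hm)

omit hWne hdisj in
theorem Src.mono {D : ℕ → ℕ → Prop} {S T : Finset ℕ} (h : Src D S) (hT : T ⊆ S) : Src D T :=
  fun U hU => h U (hU.trans hT)

theorem exists_term (k : ℕ) : ∀ S : Finset ℕ, S.card ≤ k → Conn (De Wb Eb) S → Cons Wb Eb S →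
    Src (De Wb Eb) S → ∃ δ : DTerm, δ.Good Wb Eb ∧ N δ = S := by
  induction k with
  | zero =>
    intro S hc hS
    have := hS.1
    simp at hc
    simp [hc] at this
  | succ k ih =>
    intro S hc hS hC hA
    obtain ⟨x, hx, hsx⟩ := hA S subset_rfl hS.1
    by_cases hX : (S \ {x}).Nonempty
    · obtain ⟨C, hCX, hCc, hCcl⟩ := exists_comp (De Wb Eb) _ hX
      have hxC : x ∉ C := fun h => by simpa using hCX h
      have hCS : C ⊆ S := fun y hy => (Finset.mem_sdiff.1 (hCX hy)).1
      have hL : Conn (De Wb Eb) (S \ C) := by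
        refine conn_sdiff _ hS (conn_singleton _ x) (by simpa using hx) ?_ ?_
        · intro y hy
          simpa using hCX hy
        · intro y hy z hz hzx
          exact hCcl y hy z (Finset.mem_sdiff.2 ⟨hz, hzx⟩)
      have hsp : Spl (De Wb Eb) S (S \ C) C := by
        refine ⟨Finset.sdiff_union_of_subset hCS, Finset.sdiff_disjoint, hL, hCc, ?_⟩
        intro u hu v hv huv
        rw [Finset.mem_sdiff] at hv
        by_cases hvx : v = x
        · subst hvx
          exact hsx u (hCS hu) huv
        · exact hv.2 (hCcl u hu v (by simp [hv.1, hvx]) (Or.inl huv))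
      have c1 : C.card < S.card := Finset.card_lt_card ⟨hCS, fun h => hxC (h hx)⟩
      have c2 : (S \ C).card < S.card := by
        have := hCc.1.card_pos
        rw [Finset.card_sdiff_of_subset hCS]; omega
      obtain ⟨l, gl, nl⟩ := ih (S \ C) (by omega) hL (hC.mono _ _ Finset.sdiff_subset)
        (hA.mono Finset.sdiff_subset)
      obtain ⟨r, gr, nr⟩ := ih C (by omega) hCc (hC.mono _ _ hCS) (hA.mono hCS)
      subst nr
      refine ⟨DTerm.box l r, good_box Wb Eb hWne hdisj hS hC gl gr (nl ▸ hsp), ?_⟩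
      rw [N, nl, hsp.un]
    · refine ⟨DTerm.basic x, trivial, ?_⟩
      rw [N]
      ext y
      constructor
      · intro h; simp at h; exact h ▸ hx
      · intro h
        by_contra h'
        exact hX ⟨y, Finset.mem_sdiff.2 ⟨h, h'⟩⟩

omit hWne hdisj in
theorem deriv_N {δ δ' : DTerm} (h : Deriv Wb Eb δ δ') : N δ = N δ' := by
  induction h with
  | refl => rfl
  | ass1 => simp [N, Finset.union_assoc]
  | ass21 => simp only [N]; exact Finset.union_right_comm _ _ _
  | ass22 => simp [N, Finset.union_left_comm]
  | symm _ ih => exact ih.symm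
  | trans _ _ h1 h2 => exact h1.trans h2
  | congr _ _ _ _ h1 h2 => simp only [N, h1, h2]

end terms
end SBox
namespace SBox
section comp
variable (Wb Eb : ℕ → Finset ℕ)

structure Ctx (S : Finset ℕ) : Prop where
  conn : Conn (De Wb Eb) S
  cons : Cons Wb Eb S
  src : Src (De Wb Eb) S
  ih : ∀ T ⊆ S, T ≠ S → ∀ δ δ' : DTerm, δ.Good Wb Eb → δ'.Good Wb Eb → N δ = T → N δ' = T →
    Deriv Wb Eb δ δ'

def Eqv (L R L' R' : Finset ℕ) : Prop :=
  ∀ l r l' r' : DTerm, l.Good Wb Eb → r.Good Wb Eb → l'.Good Wb Eb → r'.Good Wb Eb →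
    N l = L → N r = R → N l' = L' → N r' = R' → Deriv Wb Eb (l.box r) (l'.box r')

theorem Eqv.symm {L R L' R' : Finset ℕ} (h : Eqv Wb Eb L R L' R') : Eqv Wb Eb L' R' L R :=
  fun l r l' r' a b c d e f g i => (h l' r' l r c d a b g i e f).symm

theorem Spl.subL {D : ℕ → ℕ → Prop} {S L R : Finset ℕ} (h : Spl D S L R) : L ⊆ S :=
  h.un ▸ Finset.subset_union_left

theorem Spl.subR {D : ℕ → ℕ → Prop} {S L R : Finset ℕ} (h : Spl D S L R) : R ⊆ S :=
  h.un ▸ Finset.subset_union_right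

theorem Spl.neL {D : ℕ → ℕ → Prop} {S L R : Finset ℕ} (h : Spl D S L R) : L ≠ S := by
  rintro rfl
  obtain ⟨x, hx⟩ := h.cr.1
  exact Finset.disjoint_left.1 h.disj (h.subR hx) hx

theorem Spl.neR {D : ℕ → ℕ → Prop} {S L R : Finset ℕ} (h : Spl D S L R) : R ≠ S := by
  rintro rfl
  obtain ⟨x, hx⟩ := h.cl.1
  exact Finset.disjoint_left.1 h.disj hx (h.subL hx)

theorem Spl.mem {D : ℕ → ℕ → Prop} {S L R : Finset ℕ} (h : Spl D S L R) (x : ℕ) :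
    x ∈ R ↔ x ∈ S ∧ x ∉ L := by
  have h1 := h.un
  have h2 : x ∈ L → x ∉ R := fun h' => Finset.disjoint_left.1 h.disj h'
  rw [← h1, Finset.mem_union]
  tauto

theorem Spl.mk' {D : ℕ → ℕ → Prop} {S L R : Finset ℕ} (hL : L ⊆ S) (hR : ∀ x, x ∈ R ↔ x ∈ S ∧ x ∉ L)
    (cl : Conn D L) (cr : Conn D R) (no : ∀ x ∈ R, ∀ y ∈ L, ¬ D x y) : Spl D S L R := by
  refine ⟨?_, ?_, cl, cr, no⟩
  · ext x
    rw [Finset.mem_union, hR]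
    constructor
    · rintro (h | h)
      · exact hL h
      · exact h.1
    · intro h; tauto
  · rw [Finset.disjoint_left]
    intro x h1 h2
    exact ((hR x).1 h2).2 h1

variable (hWne : ∀ n, (Wb n).Nonempty)
    (hdisj : ∀ n, Disjoint (Wb n) (Eb n))
include hWne hdisj

theorem Ctx.term {S : Finset ℕ} (c : Ctx Wb Eb S) {T : Finset ℕ} (hT : T ⊆ S)
    (h : Conn (De Wb Eb) T) : ∃ δ : DTerm, δ.Good Wb Eb ∧ N δ = T :=
  exists_term Wb Eb hWne hdisj T.card T le_rfl h (c.cons.mono _ _ hT) (c.src.mono hT)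

theorem Ctx.box {S : Finset ℕ} (c : Ctx Wb Eb S) {T L R : Finset ℕ} (hT : T ⊆ S)
    (hc : Conn (De Wb Eb) T) (h : Spl (De Wb Eb) T L R) {l r : DTerm}
    (gl : l.Good Wb Eb) (gr : r.Good Wb Eb) (nl : N l = L) (nr : N r = R) :
    (l.box r).Good Wb Eb ∧ N (l.box r) = T := by
  subst nl; subst nr
  exact ⟨good_box Wb Eb hWne hdisj hc (c.cons.mono _ _ hT) gl gr h, h.un⟩

theorem Ctx.congr {S : Finset ℕ} (c : Ctx Wb Eb S) {L R : Finset ℕ}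
    (h : Spl (De Wb Eb) S L R) : Eqv Wb Eb L R L R := by
  intro l r l' r' gl gr gl' gr' nl nr nl' nr'
  exact Deriv.congr (c.ih L h.subL h.neL l l' gl gl' nl nl') (c.ih R h.subR h.neR r r' gr gr' nr nr')
    (c.box Wb Eb hWne hdisj subset_rfl c.conn h gl gr nl nr).1
    (c.box Wb Eb hWne hdisj subset_rfl c.conn h gl' gr' nl' nr').1

theorem Ctx.trans {S : Finset ℕ} (c : Ctx Wb Eb S) {L R L' R' L'' R'' : Finset ℕ}
    (h : Spl (De Wb Eb) S L' R') (h1 : Eqv Wb Eb L R L' R') (h2 : Eqv Wb Eb L' R' L'' R'') :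
    Eqv Wb Eb L R L'' R'' := by
  intro l r l' r' gl gr gl' gr' nl nr nl' nr'
  obtain ⟨l0, a1, a2⟩ := c.term Wb Eb hWne hdisj h.subL h.cl
  obtain ⟨r0, b1, b2⟩ := c.term Wb Eb hWne hdisj h.subR h.cr
  exact (h1 l r l0 r0 gl gr a1 b1 nl nr a2 b2).trans (h2 l0 r0 l' r' a1 b1 gl' gr' a2 b2 nl' nr')

/-- From one derivation to `Eqv`. -/
theorem Ctx.of_one {S : Finset ℕ} (c : Ctx Wb Eb S) {L R L' R' : Finset ℕ}
    (h : Spl (De Wb Eb) S L R) (h' : Spl (De Wb Eb) S L' R') {l r l' r' : DTerm}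
    (gl : l.Good Wb Eb) (gr : r.Good Wb Eb) (gl' : l'.Good Wb Eb) (gr' : r'.Good Wb Eb)
    (nl : N l = L) (nr : N r = R) (nl' : N l' = L') (nr' : N r' = R')
    (hd : (l.box r).Good Wb Eb → (l'.box r').Good Wb Eb → Deriv Wb Eb (l.box r) (l'.box r')) :
    Eqv Wb Eb L R L' R' := by
  intro a b a' b' ga gb ga' gb' na nb na' nb'
  have hd := hd (c.box Wb Eb hWne hdisj subset_rfl c.conn h gl gr nl nr).1
    (c.box Wb Eb hWne hdisj subset_rfl c.conn h' gl' gr' nl' nr').1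
  exact ((c.congr Wb Eb hWne hdisj h a b l r ga gb gl gr na nb nl nr).trans hd).trans
    (c.congr Wb Eb hWne hdisj h' l' r' a' b' gl' gr' ga' gb' nl' nr' na' nb')

theorem Ctx.step {S : Finset ℕ} (c : Ctx Wb Eb S) {L R L' R' : Finset ℕ}
    (h : Spl (De Wb Eb) S L R) (h' : Spl (De Wb Eb) S L' R') (hLL : L ⊆ L')
    (hM : Conn (De Wb Eb) (L' \ L)) : Eqv Wb Eb L R L' R' := by
  have m1 := h.mem
  have m2 := h'.mem
  have s1 := h.subL
  have s2 := h'.subL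
  have hMS : L' \ L ⊆ S := Finset.sdiff_subset.trans s2
  obtain ⟨l, gl, nl⟩ := c.term Wb Eb hWne hdisj h.subL h.cl
  obtain ⟨m, gm, nm⟩ := c.term Wb Eb hWne hdisj hMS hM
  obtain ⟨r, gr, nr⟩ := c.term Wb Eb hWne hdisj h'.subR h'.cr
  have sp1 : Spl (De Wb Eb) L' L (L' \ L) := by
    refine Spl.mk' hLL (fun x => Finset.mem_sdiff) h.cl hM ?_
    intro x hx
    rw [Finset.mem_sdiff] at hx
    exact h.no x ((m1 x).2 ⟨s2 hx.1, hx.2⟩)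
  have sp2 : Spl (De Wb Eb) R (L' \ L) R' := by
    refine Spl.mk' ?_ ?_ hM h'.cr ?_
    · intro x hx
      rw [Finset.mem_sdiff] at hx
      exact (m1 x).2 ⟨s2 hx.1, hx.2⟩
    · intro x
      rw [Finset.mem_sdiff, m1, m2]
      have := @hLL x
      tauto
    · intro x hx y hy
      exact h'.no x hx y (Finset.mem_sdiff.1 hy).1
  have b1 := c.box Wb Eb hWne hdisj s2 h'.cl sp1 gl gm nl nm
  have b2 := c.box Wb Eb hWne hdisj h.subR h.cr sp2 gm gr nm nr
  exact c.of_one Wb Eb hWne hdisj h h' gl b2.1 b1.1 gr nl b2.2 b1.2 nr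
    (fun g1 g2 => (Deriv.ass1 l m r g2 g1).symm)

theorem Ctx.nested {S : Finset ℕ} (c : Ctx Wb Eb S) {L' R' : Finset ℕ}
    (h' : Spl (De Wb Eb) S L' R') (k : ℕ) : ∀ L R : Finset ℕ, (L' \ L).card ≤ k →
    Spl (De Wb Eb) S L R → L ⊆ L' → Eqv Wb Eb L R L' R' := by
  induction k with
  | zero =>
    intro L R hk h hLL
    have hL : L = L' := by
      apply hLL.antisymm
      rw [← Finset.sdiff_eq_empty_iff_subset]
      simpa using hk
    subst hL
    have : R = R' := by ext x; rw [h.mem, h'.mem]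
    subst this
    exact c.congr Wb Eb hWne hdisj h
  | succ k ih =>
    intro L R hk h hLL
    rcases (L' \ L).eq_empty_or_nonempty with he | hne
    · exact ih L R (by simp [he]) h hLL
    obtain ⟨C, hCM, hCc, hCcl⟩ := exists_comp (De Wb Eb) _ hne
    have mC : ∀ x ∈ C, x ∈ L' ∧ x ∉ L := fun x hx => Finset.mem_sdiff.1 (hCM hx)
    have m1 := h.mem
    have m2 := h'.mem
    have s1 := h.subL
    have s2 := h'.subL
    have hcl : ∀ x ∈ C, ∀ y ∈ L', y ∉ L → adj (De Wb Eb) x y → y ∈ C := fun x hx y hy hy' =>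
      hCcl x hx y (Finset.mem_sdiff.2 ⟨hy, hy'⟩)
    have hsp : Spl (De Wb Eb) S (L ∪ C) (R \ C) := by
      refine Spl.mk' ?_ ?_ ?_ ?_ ?_
      · exact Finset.union_subset s1 (fun x hx => s2 (mC x hx).1)
      · intro x
        rw [Finset.mem_sdiff, m1, Finset.mem_union]
        tauto
      · have : L ∪ C = L' \ ((L' \ L) \ C) := by
          ext x
          simp only [Finset.mem_union, Finset.mem_sdiff]
          have := mC x
          have := @hLL x
          tauto
        rw [this]
        refine conn_sdiff _ h'.cl h.cl hLL ?_ ?_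
        · intro x hx
          simp only [Finset.mem_sdiff] at hx
          exact hx.1
        · intro x hx y hy hyL hxy
          simp only [Finset.mem_sdiff] at hx ⊢
          exact ⟨⟨hy, hyL⟩, fun hyC => hx.2 (hcl y hyC x hx.1.1 hx.1.2 (adj_symm hxy))⟩
      · refine conn_sdiff _ h.cr h'.cr ?_ ?_ ?_
        · intro x hx
          rw [m2] at hx
          exact (m1 x).2 ⟨hx.1, fun hx' => hx.2 (hLL hx')⟩
        · intro x hx
          have := mC x hx
          rw [m1, m2]
          exact ⟨⟨s2 this.1, this.2⟩, fun h => h.2 this.1⟩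
        · intro x hx y hy hy' hxy
          rw [m1] at hy
          rw [m2] at hy'
          exact hcl x hx y (by tauto) hy.2 hxy
      · intro x hx y hy hxy
        rw [Finset.mem_sdiff] at hx
        rcases Finset.mem_union.1 hy with hy | hy
        · exact h.no x hx.1 y hy hxy
        · have hxL' : x ∈ L' := by
            by_contra hxL'
            exact h'.no x ((m2 x).2 ⟨h.subR hx.1, hxL'⟩) y (mC y hy).1 hxy
          exact hx.2 (hcl y hy x hxL' ((m1 x).1 hx.1).2 (Or.inr hxy))
    have hd : (L ∪ C) \ L = C := by
      ext x
      simp only [Finset.mem_union, Finset.mem_sdiff]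
      have := mC x
      tauto
    refine c.trans Wb Eb hWne hdisj hsp
      (c.step Wb Eb hWne hdisj h hsp Finset.subset_union_left (hd.symm ▸ hCc)) ?_
    refine ih _ _ ?_ hsp (Finset.union_subset hLL fun x hx => (mC x hx).1)
    have : (L' \ (L ∪ C)).card < (L' \ L).card := by
      apply Finset.card_lt_card
      refine ⟨fun x hx => ?_, fun hh => ?_⟩
      · simp only [Finset.mem_union, Finset.mem_sdiff] at hx ⊢
        tauto
      · obtain ⟨x, hx⟩ := hCc.1
        have := hh (hCM hx)
        simp [hx] at this
    omega

theorem Ctx.eqv {S : Finset ℕ} (c : Ctx Wb Eb S) {L R L' R' : Finset ℕ}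
    (h : Spl (De Wb Eb) S L R) (h' : Spl (De Wb Eb) S L' R') : Eqv Wb Eb L R L' R' := by
  have m1 := h.mem
  have m2 := h'.mem
  have s1 := h.subL
  have s2 := h'.subL
  have hin : ∀ x ∈ S, x ∈ L ∨ x ∈ R := fun x hx => by rw [m1]; tauto
  have hin' : ∀ x ∈ S, x ∈ L' ∨ x ∈ R' := fun x hx => by rw [m2]; tauto
  rcases (R ∩ R').eq_empty_or_nonempty with hR | hR
  · -- R and R' disjoint
    have dR : ∀ x ∈ R, x ∉ R' := fun x a b => by
      have : x ∈ R ∩ R' := Finset.mem_inter.2 ⟨a, b⟩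
      simp [hR] at this
    have rl : ∀ x ∈ R, x ∈ L' := fun x hx => (hin' x (h.subR hx)).resolve_right (dR x hx)
    have rl' : ∀ x ∈ R', x ∈ L := fun x hx =>
      (hin x (h'.subR hx)).resolve_right (fun hh => dR x hh hx)
    have hDne : (L ∩ L').Nonempty := by
      by_contra hno
      rw [Finset.not_nonempty_iff_eq_empty] at hno
      have dL : ∀ x ∈ L, x ∉ L' := fun x a b => by
        have : x ∈ L ∩ L' := Finset.mem_inter.2 ⟨a, b⟩
        simp [hno] at this
      obtain ⟨a, ha, b, hb, hab⟩ := conn_edge _ (h.un.symm ▸ c.conn) h.cl.1 h.cr.1 h.disj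
      have hb' := rl b hb
      have ha' := (hin' a (s1 ha)).resolve_left (dL a ha)
      rcases hab with hab | hab
      · exact h'.no a ha' b hb' hab
      · exact h.no b hb a ha hab
    obtain ⟨C, hCM, hCc, hCcl⟩ := exists_comp (De Wb Eb) _ hDne
    have mC : ∀ x ∈ C, x ∈ L ∧ x ∈ L' := fun x hx => Finset.mem_inter.1 (hCM hx)
    have hcl : ∀ x ∈ C, ∀ y ∈ L, y ∈ L' → adj (De Wb Eb) x y → y ∈ C := fun x hx y hy hy' =>
      hCcl x hx y (Finset.mem_inter.2 ⟨hy, hy'⟩)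
    by_cases hall : L ∩ L' ⊆ C
    · have hCe : C = L ∩ L' := hCM.antisymm hall
      have hCS : C ⊆ S := fun x hx => s1 (mC x hx).1
      obtain ⟨d1, g1, n1⟩ := c.term Wb Eb hWne hdisj hCS hCc
      obtain ⟨d2, g2, n2⟩ := c.term Wb Eb hWne hdisj h'.subR h'.cr
      obtain ⟨d3, g3, n3⟩ := c.term Wb Eb hWne hdisj h.subR h.cr
      have sp1 : Spl (De Wb Eb) L C R' := by
        refine Spl.mk' (fun x hx => (mC x hx).1) ?_ hCc h'.cr ?_
        · intro x
          rw [hCe, Finset.mem_inter]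
          constructor
          · intro hx
            exact ⟨rl' x hx, fun hh => ((m2 x).1 hx).2 hh.2⟩
          · rintro ⟨a, b⟩
            rw [m2]
            exact ⟨s1 a, fun hh => b ⟨a, hh⟩⟩
        · intro x hx y hy
          exact h'.no x hx y (mC y hy).2
      have sp2 : Spl (De Wb Eb) L' C R := by
        refine Spl.mk' (fun x hx => (mC x hx).2) ?_ hCc h.cr ?_
        · intro x
          rw [hCe, Finset.mem_inter]
          constructor
          · intro hx
            exact ⟨rl x hx, fun hh => ((m1 x).1 hx).2 hh.1⟩
          · rintro ⟨a, b⟩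
            rw [m1]
            exact ⟨s2 a, fun hh => b ⟨hh, a⟩⟩
        · intro x hx y hy
          exact h.no x hx y (mC y hy).1
      have b1 := c.box Wb Eb hWne hdisj s1 h.cl sp1 g1 g2 n1 n2
      have b2 := c.box Wb Eb hWne hdisj s2 h'.cl sp2 g1 g3 n1 n3
      exact c.of_one Wb Eb hWne hdisj h h' b1.1 g3 b2.1 g2 b1.2 n3 b2.2 n2
        (fun g g' => Deriv.ass21 d1 d2 d3 g g')
    · obtain ⟨z, hz, hzC⟩ := Finset.not_subset.1 hall
      rw [Finset.mem_inter] at hz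
      have c1 : Conn (De Wb Eb) (L \ C) := by
        refine conn_sdiff _ h.cl h'.cr rl' ?_ ?_
        · intro x hx
          exact ⟨(mC x hx).1, fun hh => ((m2 x).1 hh).2 (mC x hx).2⟩
        · intro x hx y hy hy'
          exact hcl x hx y hy ((hin' y (s1 hy)).resolve_right hy')
      have c2 : Conn (De Wb Eb) (L' \ C) := by
        refine conn_sdiff _ h'.cl h.cr rl ?_ ?_
        · intro x hx
          exact ⟨(mC x hx).2, fun hh => ((m1 x).1 hh).2 (mC x hx).1⟩
        · intro x hx y hy hy'
          exact hcl x hx y ((hin y (s2 hy)).resolve_right hy') hy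
      have c3 := conn_union _ c1 c2 (Finset.mem_sdiff.2 ⟨hz.1, hzC⟩)
        (Finset.mem_sdiff.2 ⟨hz.2, hzC⟩) (Or.inl rfl)
      have hsp : Spl (De Wb Eb) S C ((L \ C) ∪ (L' \ C)) := by
        refine Spl.mk' (fun x hx => s1 (mC x hx).1) ?_ hCc c3 ?_
        · intro x
          simp only [Finset.mem_union, Finset.mem_sdiff]
          constructor
          · rintro (a | a)
            · exact ⟨s1 a.1, a.2⟩
            · exact ⟨s2 a.1, a.2⟩
          · rintro ⟨a, b⟩
            rcases hin x a with hh | hh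
            · exact Or.inl ⟨hh, b⟩
            · exact Or.inr ⟨rl x hh, b⟩
        · intro x hx y hy hxy
          have hxC : x ∉ C := by
            simp only [Finset.mem_union, Finset.mem_sdiff] at hx
            tauto
          have hxS : x ∈ S := by
            simp only [Finset.mem_union, Finset.mem_sdiff] at hx
            rcases hx with hx | hx
            · exact s1 hx.1
            · exact s2 hx.1
          have hyC := mC y hy
          have a1 := (hin x hxS).resolve_right (fun hh => h.no x hh y hyC.1 hxy)
          have a2 := (hin' x hxS).resolve_right (fun hh => h'.no x hh y hyC.2 hxy)
          exact hxC (hcl y hy x a1 a2 (Or.inr hxy))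
      exact c.trans Wb Eb hWne hdisj hsp
        (c.nested Wb Eb hWne hdisj h _ C _ le_rfl hsp (fun x hx => (mC x hx).1)).symm
        (c.nested Wb Eb hWne hdisj h' _ C _ le_rfl hsp (fun x hx => (mC x hx).2))
  · obtain ⟨C, hCM, hCc, hCcl⟩ := exists_comp (De Wb Eb) _ hR
    have mC : ∀ x ∈ C, x ∈ R ∧ x ∈ R' := fun x hx => Finset.mem_inter.1 (hCM hx)
    have hcl : ∀ x ∈ C, ∀ y ∈ R, y ∈ R' → adj (De Wb Eb) x y → y ∈ C := fun x hx y hy hy' =>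
      hCcl x hx y (Finset.mem_inter.2 ⟨hy, hy'⟩)
    have hCS : C ⊆ S := fun x hx => h.subR (mC x hx).1
    have big : Conn (De Wb Eb) (S \ C) → Eqv Wb Eb L R L' R' := by
      intro hc
      have hsp : Spl (De Wb Eb) S (S \ C) C := by
        refine ⟨Finset.sdiff_union_of_subset hCS, Finset.sdiff_disjoint, hc, hCc, ?_⟩
        intro x hx y hy hxy
        rw [Finset.mem_sdiff] at hy
        have hxC := mC x hx
        have a1 := (hin y hy.1).resolve_left (fun hh => h.no x hxC.1 y hh hxy)
        have a2 := (hin' y hy.1).resolve_left (fun hh => h'.no x hxC.2 y hh hxy)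
        exact hy.2 (hcl x hx y a1 a2 (Or.inl hxy))
      exact c.trans Wb Eb hWne hdisj hsp
        (c.nested Wb Eb hWne hdisj hsp _ L R le_rfl h (fun x hx =>
          Finset.mem_sdiff.2 ⟨s1 hx, fun hh => ((m1 x).1 (mC x hh).1).2 hx⟩))
        (c.nested Wb Eb hWne hdisj hsp _ L' R' le_rfl h' (fun x hx =>
          Finset.mem_sdiff.2 ⟨s2 hx, fun hh => ((m2 x).1 (mC x hh).2).2 hx⟩)).symm
    by_cases hL : (L ∩ L').Nonempty
    · apply big
      obtain ⟨z, hz⟩ := hL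
      rw [Finset.mem_inter] at hz
      have c3 := conn_union _ h.cl h'.cl hz.1 hz.2 (Or.inl rfl)
      refine conn_sdiff _ c.conn c3 (Finset.union_subset s1 s2) ?_ ?_
      · intro x hx
        refine ⟨hCS hx, fun hh => ?_⟩
        rcases Finset.mem_union.1 hh with hh | hh
        · exact ((m1 x).1 (mC x hx).1).2 hh
        · exact ((m2 x).1 (mC x hx).2).2 hh
      · intro x hx y hy hy'
        rw [Finset.mem_union, not_or] at hy'
        exact hcl x hx y ((hin y hy).resolve_left hy'.1) ((hin' y hy).resolve_left hy'.2)
    · rw [Finset.not_nonempty_iff_eq_empty] at hL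
      have dL : ∀ x ∈ L, x ∉ L' := fun x a b => by
        have : x ∈ L ∩ L' := Finset.mem_inter.2 ⟨a, b⟩
        simp [hL] at this
      have lr : ∀ x ∈ L, x ∈ R' := fun x hx => (hin' x (s1 hx)).resolve_left (dL x hx)
      have lr' : ∀ x ∈ L', x ∈ R := fun x hx =>
        (hin x (s2 hx)).resolve_left (fun hh => dL x hh hx)
      by_cases hall : R ∩ R' ⊆ C
      · have hCe : C = R ∩ R' := hCM.antisymm hall
        obtain ⟨d1, g1, n1⟩ := c.term Wb Eb hWne hdisj s1 h.cl
        obtain ⟨d2, g2, n2⟩ := c.term Wb Eb hWne hdisj s2 h'.cl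
        obtain ⟨d3, g3, n3⟩ := c.term Wb Eb hWne hdisj hCS hCc
        have sp1 : Spl (De Wb Eb) R L' C := by
          refine Spl.mk' lr' ?_ h'.cl hCc ?_
          · intro x
            rw [hCe, Finset.mem_inter, m2]
            have := @s1 x
            have := m1 x
            tauto
          · intro x hx
            exact h'.no x (mC x hx).2
        have sp2 : Spl (De Wb Eb) R' L C := by
          refine Spl.mk' lr ?_ h.cl hCc ?_
          · intro x
            rw [hCe, Finset.mem_inter, m1]
            have := m2 x
            tauto
          · intro x hx
            exact h.no x (mC x hx).1
        have b1 := c.box Wb Eb hWne hdisj h.subR h.cr sp1 g2 g3 n2 n3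
        have b2 := c.box Wb Eb hWne hdisj h'.subR h'.cr sp2 g1 g3 n1 n3
        exact c.of_one Wb Eb hWne hdisj h h' g1 b1.1 g2 b2.1 n1 b1.2 n2 b2.2
          (fun g g' => Deriv.ass22 d1 d2 d3 g g')
      · apply big
        obtain ⟨z, hz, hzC⟩ := Finset.not_subset.1 hall
        rw [Finset.mem_inter] at hz
        have c1 : Conn (De Wb Eb) (R \ C) := by
          refine conn_sdiff _ h.cr h'.cl lr' ?_ ?_
          · intro x hx
            exact ⟨(mC x hx).1, fun hh => ((m2 x).1 (mC x hx).2).2 hh⟩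
          · intro x hx y hy hy'
            exact hcl x hx y hy ((hin' y (h.subR hy)).resolve_left hy')
        have c2 : Conn (De Wb Eb) (R' \ C) := by
          refine conn_sdiff _ h'.cr h.cl lr ?_ ?_
          · intro x hx
            exact ⟨(mC x hx).2, fun hh => ((m1 x).1 (mC x hx).1).2 hh⟩
          · intro x hx y hy hy'
            exact hcl x hx y ((hin y (h'.subR hy)).resolve_left hy') hy
        have c3 := conn_union _ c1 c2 (Finset.mem_sdiff.2 ⟨hz.1, hzC⟩)
          (Finset.mem_sdiff.2 ⟨hz.2, hzC⟩) (Or.inl rfl)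
        have he : S \ C = (R \ C) ∪ (R' \ C) := by
          ext x
          simp only [Finset.mem_union, Finset.mem_sdiff]
          constructor
          · rintro ⟨a, b⟩
            rcases hin x a with hh | hh
            · exact Or.inr ⟨lr x hh, b⟩
            · exact Or.inl ⟨hh, b⟩
          · rintro (a | a)
            · exact ⟨h.subR a.1, a.2⟩
            · exact ⟨h'.subR a.1, a.2⟩
        rw [he]
        exact c3

omit hWne in
theorem complete (hWne : ∀ n, (Wb n).Nonempty) (k : ℕ) : ∀ δ δ' : DTerm, (N δ).card ≤ k →
    δ.Good Wb Eb → δ'.Good Wb Eb → N δ = N δ' → Deriv Wb Eb δ δ' := by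
  induction k with
  | zero =>
    intro δ δ' hk g
    have := (facts Wb Eb hWne hdisj δ g).1.conn.1.card_pos
    omega
  | succ k ih =>
    intro δ δ' hk g g' hN
    have f := facts Wb Eb hWne hdisj δ g
    have f' := facts Wb Eb hWne hdisj δ' g'
    have c : Ctx Wb Eb (N δ) := by
      refine ⟨f.1.conn, f.1.cons, f.1.src, ?_⟩
      intro T hT hne a b ga gb na nb
      refine ih a b ?_ ga gb (na.trans nb.symm)
      have := Finset.card_lt_card (hT.ssubset_of_ne hne)
      rw [na]
      omega
    have bad : ∀ (n : ℕ) (l r : DTerm), Spl (De Wb Eb) {n} (N l) (N r) → False := by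
      intro n l r h
      obtain ⟨x, hx⟩ := h.cl.1
      obtain ⟨y, hy⟩ := h.cr.1
      have a1 := h.subL hx
      have a2 := h.subR hy
      simp at a1 a2
      subst a1; subst a2
      exact Finset.disjoint_left.1 h.disj hx hy
    cases δ with
    | basic n =>
      cases δ' with
      | basic m =>
        simp [N] at hN
        subst hN
        exact Deriv.refl _ g
      | box l' r' =>
        have := f'.2 l' r' rfl
        rw [← hN] at this
        exact (bad n l' r' this).elim
    | box l r =>
      cases δ' with
      | basic m =>
        have := f.2 l r rfl
        rw [hN] at this
        exact (bad m l r this).elim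
      | box l' r' =>
        have h := f.2 l r rfl
        have h' := f'.2 l' r' rfl
        rw [← hN] at h'
        exact c.eqv Wb Eb hWne hdisj h h' l r l' r' g.1 g.2.1 g'.1 g'.2.1 rfl rfl rfl rfl

end comp

section iota
variable (Wb Eb : ℕ → Finset ℕ) (ve vb : ℕ → ℕ)

structure IFacts (δ : DTerm) : Prop where
  a : (δ.iota Wb Eb ve vb).A = δ.Aset Wb Eb
  v : ∀ v, v ∈ (δ.iota Wb Eb ve vb).V ↔ (∃ n ∈ N δ, v = vb n) ∨
    (∃ e, (e ∈ δ.Wset Wb Eb ∨ e ∈ δ.Eset Wb Eb) ∧ v = ve e)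
  w0 : ∀ e, e ∉ δ.Aset Wb Eb → (δ.iota Wb Eb ve vb).W e = 0
  w1 : ∀ e, e ∈ δ.Wset Wb Eb → (δ.iota Wb Eb ve vb).W e = ve e
  w2 : ∀ n ∈ N δ, ∀ e ∈ Eb n, (δ.iota Wb Eb ve vb).W e = vb n
  e0 : ∀ e, e ∉ δ.Aset Wb Eb → (δ.iota Wb Eb ve vb).E e = 0
  e1 : ∀ e, e ∈ δ.Eset Wb Eb → (δ.iota Wb Eb ve vb).E e = ve e
  e2 : ∀ n ∈ N δ, ∀ e ∈ Wb n, (δ.iota Wb Eb ve vb).E e = vb n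

theorem ifacts (hWne : ∀ n, (Wb n).Nonempty)
    (hdisj : ∀ n, Disjoint (Wb n) (Eb n))
    (hve : Function.Injective ve) (hsep : ∀ e n, ve e ≠ vb n)
    (δ : DTerm) (g : δ.Good Wb Eb) : IFacts Wb Eb ve vb δ := by
  induction δ with
  | basic n =>
    have hd : ∀ e, e ∈ Wb n → e ∉ Eb n := fun e he => Finset.disjoint_left.1 (hdisj n) he
    constructor <;> simp only [DTerm.iota, DTerm.Aset, DTerm.Wset, DTerm.Eset, N,
      Finset.mem_singleton, Finset.mem_union, Finset.mem_image] <;> grind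
  | box l r ihl ihr =>
    have il := ihl g.1
    have ir := ihr g.2.1
    have f := (facts Wb Eb hWne hdisj _ g).1
    have fl := (facts Wb Eb hWne hdisj l g.1).1
    have fr := (facts Wb Eb hWne hdisj r g.2.1).1
    have cr := fun {n m e : ℕ} => @cross Wb Eb l r fl fr g.2.2.2 n m e
    have hA := mem_Aset Wb Eb
    have hlW : ∀ e, e ∈ l.Wset Wb Eb → e ∈ l.Aset Wb Eb := by
      intro e he; rw [fl.w] at he; rw [hA]; grind
    have hlE : ∀ e, e ∈ l.Eset Wb Eb → e ∈ l.Aset Wb Eb := by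
      intro e he; rw [fl.e] at he; rw [hA]; grind
    have hrW : ∀ e, e ∈ r.Wset Wb Eb → e ∈ r.Aset Wb Eb := by
      intro e he; rw [fr.w] at he; rw [hA]; grind
    have hrE : ∀ e, e ∈ r.Eset Wb Eb → e ∈ r.Aset Wb Eb := by
      intro e he; rw [fr.e] at he; rw [hA]; grind
    have hC : ∀ e, e ∈ l.Aset Wb Eb → e ∈ r.Aset Wb Eb → e ∈ l.Eset Wb Eb ∧ e ∈ r.Wset Wb Eb := by
      intro e h1 h2
      have : e ∈ l.Aset Wb Eb ∩ r.Aset Wb Eb := Finset.mem_inter.2 ⟨h1, h2⟩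
      rwa [g.2.2.2, Finset.mem_inter] at this
    have hlWE : ∀ e, e ∈ l.Wset Wb Eb → e ∉ l.Eset Wb Eb := by
      intro e h1 h2; rw [fl.w] at h1; rw [fl.e] at h2; grind
    have hrWE : ∀ e, e ∈ r.Wset Wb Eb → e ∉ r.Eset Wb Eb := by
      intro e h1 h2; rw [fr.w] at h1; rw [fr.e] at h2; grind
    constructor
    · simp [DTerm.iota, DGr.junc, DTerm.Aset, il.a, ir.a]
    · intro v
      simp only [DTerm.iota, DGr.junc, DTerm.Wset, DTerm.Eset, N, il.a, ir.a, Finset.mem_sdiff,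
        Finset.mem_union, Finset.mem_inter, Finset.mem_image, il.v, ir.v]
      constructor
      · rintro ⟨(⟨n, hn, rfl⟩ | ⟨e, he, rfl⟩) | (⟨n, hn, rfl⟩ | ⟨e, he, rfl⟩), h2⟩
        · exact Or.inl ⟨n, Or.inl hn, rfl⟩
        · refine Or.inr ⟨e, ?_, rfl⟩
          have : ¬ (e ∈ l.Aset Wb Eb ∧ e ∈ r.Aset Wb Eb) :=
            fun h => h2 ⟨e, h, il.e1 e (hC e h.1 h.2).1⟩
          tauto
        · exact Or.inl ⟨n, Or.inr hn, rfl⟩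
        · refine Or.inr ⟨e, ?_, rfl⟩
          have : ¬ (e ∈ l.Aset Wb Eb ∧ e ∈ r.Aset Wb Eb) :=
            fun h => h2 ⟨e, h, il.e1 e (hC e h.1 h.2).1⟩
          tauto
      · rintro (⟨n, hn, rfl⟩ | ⟨e, he, rfl⟩)
        · refine ⟨?_, ?_⟩
          · rcases hn with hn | hn
            · exact Or.inl (Or.inl ⟨n, hn, rfl⟩)
            · exact Or.inr (Or.inl ⟨n, hn, rfl⟩)
          · rintro ⟨a, ha, h⟩
            rw [il.e1 a (hC a ha.1 ha.2).1] at h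
            exact hsep _ _ h
        · refine ⟨?_, ?_⟩
          · rcases he with (he | he) | (he | he)
            · exact Or.inl (Or.inr ⟨e, Or.inl he, rfl⟩)
            · exact Or.inr (Or.inr ⟨e, Or.inl he.1, rfl⟩)
            · exact Or.inr (Or.inr ⟨e, Or.inr he, rfl⟩)
            · exact Or.inl (Or.inr ⟨e, Or.inr he.1, rfl⟩)
          · rintro ⟨a, ha, h⟩
            have hc := hC a ha.1 ha.2
            rw [il.e1 a hc.1] at h
            have := hve h
            subst this
            have := hlWE a
            have := hrWE a
            tauto
    · intro e he
      simp only [DTerm.Aset, Finset.mem_union, not_or] at he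
      simp [DTerm.iota, DGr.junc, il.a, ir.a, he]
    · intro e he
      simp only [DTerm.Wset, Finset.mem_union, Finset.mem_sdiff, Finset.mem_inter] at he
      simp only [DTerm.iota, DGr.junc, il.a, ir.a]
      rcases he with he | ⟨he, hn⟩
      · rw [if_pos (hlW e he), il.w1 e he]
      · rw [if_neg (fun h => hn ⟨h, hrW e he⟩), if_pos (hrW e he), ir.w1 e he]
    · intro n hn e he
      simp only [N, Finset.mem_union] at hn
      simp only [DTerm.iota, DGr.junc, il.a, ir.a]
      rcases hn with hn | hn
      · rw [if_pos ((hA l e).2 ⟨n, hn, Or.inr he⟩), il.w2 n hn e he]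
      · rw [if_neg, if_pos ((hA r e).2 ⟨n, hn, Or.inr he⟩), ir.w2 n hn e he]
        intro h
        obtain ⟨m, hm, h⟩ := (hA l e).1 h
        exact (cr hm hn h (Or.inr he)).2.2.2 he
    · intro e he
      simp only [DTerm.Aset, Finset.mem_union, not_or] at he
      simp [DTerm.iota, DGr.junc, il.a, ir.a, he]
    · intro e he
      simp only [DTerm.Eset, Finset.mem_union, Finset.mem_sdiff, Finset.mem_inter] at he
      simp only [DTerm.iota, DGr.junc, il.a, ir.a]
      rcases he with he | ⟨he, hn⟩
      · rw [if_pos (hrE e he), ir.e1 e he]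
      · rw [if_neg (fun h => hn ⟨hlE e he, h⟩), if_pos (hlE e he), il.e1 e he]
    · intro n hn e he
      simp only [N, Finset.mem_union] at hn
      simp only [DTerm.iota, DGr.junc, il.a, ir.a]
      rcases hn with hn | hn
      · rw [if_neg, if_pos ((hA l e).2 ⟨n, hn, Or.inl he⟩), il.e2 n hn e he]
        intro h
        obtain ⟨m, hm, h⟩ := (hA r e).1 h
        exact (cr hn hm (Or.inl he) h).2.1 he
      · rw [if_pos ((hA r e).2 ⟨n, hn, Or.inl he⟩), ir.e2 n hn e he]

theorem iota_of_N (hWne : ∀ n, (Wb n).Nonempty)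
    (hdisj : ∀ n, Disjoint (Wb n) (Eb n))
    (hve : Function.Injective ve) (hsep : ∀ e n, ve e ≠ vb n)
    (δ δ' : DTerm) (g : δ.Good Wb Eb) (g' : δ'.Good Wb Eb) (h : N δ = N δ') :
    δ.iota Wb Eb ve vb = δ'.iota Wb Eb ve vb := by
  have i := ifacts Wb Eb ve vb hWne hdisj hve hsep δ g
  have i' := ifacts Wb Eb ve vb hWne hdisj hve hsep δ' g'
  have f := (facts Wb Eb hWne hdisj δ g).1
  have f' := (facts Wb Eb hWne hdisj δ' g').1
  have hA : δ.Aset Wb Eb = δ'.Aset Wb Eb := by ext e; rw [mem_Aset, mem_Aset, h]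
  have hW : δ.Wset Wb Eb = δ'.Wset Wb Eb := by ext e; rw [f.w, f'.w, h]
  have hE : δ.Eset Wb Eb = δ'.Eset Wb Eb := by ext e; rw [f.e, f'.e, h]
  have eA : (δ.iota Wb Eb ve vb).A = (δ'.iota Wb Eb ve vb).A := by rw [i.a, i'.a, hA]
  have eV : (δ.iota Wb Eb ve vb).V = (δ'.iota Wb Eb ve vb).V := by
    ext v; rw [i.v, i'.v, hW, hE, h]
  have eW : (δ.iota Wb Eb ve vb).W = (δ'.iota Wb Eb ve vb).W := by
    funext e
    by_cases h0 : e ∈ δ.Aset Wb Eb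
    · by_cases h1 : ∃ n ∈ N δ, e ∈ Eb n
      · obtain ⟨n, hn, he⟩ := h1
        rw [i.w2 n hn e he, i'.w2 n (h ▸ hn) e he]
      · have : e ∈ δ.Wset Wb Eb := by
          rw [f.w]
          rw [mem_Aset] at h0
          grind
        rw [i.w1 e this, i'.w1 e (hW ▸ this)]
    · rw [i.w0 e h0, i'.w0 e (hA ▸ h0)]
  have eE : (δ.iota Wb Eb ve vb).E = (δ'.iota Wb Eb ve vb).E := by
    funext e
    by_cases h0 : e ∈ δ.Aset Wb Eb
    · by_cases h1 : ∃ n ∈ N δ, e ∈ Wb n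
      · obtain ⟨n, hn, he⟩ := h1
        rw [i.e2 n hn e he, i'.e2 n (h ▸ hn) e he]
      · have : e ∈ δ.Eset Wb Eb := by
          rw [f.e]
          rw [mem_Aset] at h0
          grind
        rw [i.e1 e this, i'.e1 e (hE ▸ this)]
    · rw [i.e0 e h0, i'.e0 e (hA ▸ h0)]
  cases hx : δ.iota Wb Eb ve vb
  cases hy : δ'.iota Wb Eb ve vb
  simp only [hx, hy] at eA eV eW eE
  subst eA; subst eV; subst eW; subst eE
  rfl

end iota
end SBox

/-- **Theorem 1.6.4** (soundness and completeness of S□): an equation `δ = δ'`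
between D-terms is derivable in S□ iff the D-graphs `ι(δ)` and `ι(δ')` are
the same. -/
theorem sbox_complete (Wb Eb : ℕ → Finset ℕ) (ve vb : ℕ → ℕ)
    (hWne : ∀ n, (Wb n).Nonempty) (hEne : ∀ n, (Eb n).Nonempty)
    (hdisj : ∀ n, Disjoint (Wb n) (Eb n))
    (hve : Function.Injective ve) (hvb : Function.Injective vb)
    (hsep : ∀ e n, ve e ≠ vb n)
    (δ δ' : DTerm) (hδ : δ.Good Wb Eb) (hδ' : δ'.Good Wb Eb) :
    Deriv Wb Eb δ δ' ↔ δ.iota Wb Eb ve vb = δ'.iota Wb Eb ve vb := by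
  constructor
  · intro h
    exact SBox.iota_of_N Wb Eb ve vb hWne hdisj hve hsep δ δ' hδ hδ' (SBox.deriv_N Wb Eb h)
  · intro h
    refine SBox.complete Wb Eb hdisj hWne _ δ δ' le_rfl hδ hδ' ?_
    have i := SBox.ifacts Wb Eb ve vb hWne hdisj hve hsep δ hδ
    have i' := SBox.ifacts Wb Eb ve vb hWne hdisj hve hsep δ' hδ'
    have key : ∀ δ₀ : DTerm, SBox.IFacts Wb Eb ve vb δ₀ → ∀ n,
        (vb n ∈ (δ₀.iota Wb Eb ve vb).V ↔ n ∈ SBox.N δ₀) := by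
      intro δ₀ j n
      rw [j.v]
      constructor
      · rintro (⟨m, hm, he⟩ | ⟨e, _, he⟩)
        · exact hvb he ▸ hm
        · exact absurd he.symm (hsep e n)
      · intro hn
        exact Or.inl ⟨n, hn, rfl⟩
    ext n
    rw [← key δ i, ← key δ' i', h]
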